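/- For any two positive integers q and q′, the split strengths φ({q}, complement of {q}) and φ({q′}, complement of {q′}) are equal; i.e., φ({q}, ℕ⁺∖{q}) does not depend on the value of q. -/

import Mathlib

open Filter

/-- Two permutations of `[n]` are `G(D)`-different if at some position the
absolute difference of their values lies in `D`. `T n D` is the maximum
cardinality of a set of pairwise `G(D)`-different permutations of `[n]`. -/
noncomputable def T (n : ℕ) (D : Set ℕ) : ℕ :=
  sSup {k | ∃ S : Finset (Equiv.Perm (Fin n)), S.card = k ∧
    ∀ π ∈ S, ∀ σ ∈ S, π ≠ σ →
      ∃ i : Fin n, ((π i : ℤ) - (σ i : ℤ)).natAbs ∈ D}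

/-- The split strength `φ(D, D̄) = limsup (1/n) log₂ (T(n,D)·T(n,D̄)/n!)`. -/
noncomputable def splitStrength (D Dc : Set ℕ) : ℝ :=
  Filter.atTop.limsup fun n : ℕ =>
    Real.logb 2 ((T n D : ℝ) * (T n Dc : ℝ) / (Nat.factorial n : ℝ)) / n

lemma bddAbove_card_differentFamilies (n : ℕ) (D : Set ℕ) :
    BddAbove {k | ∃ S : Finset (Equiv.Perm (Fin n)), S.card = k ∧
      ∀ π ∈ S, ∀ σ ∈ S, π ≠ σ →
        ∃ i : Fin n, ((π i : ℤ) - (σ i : ℤ)).natAbs ∈ D} := by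
  refine ⟨Fintype.card (Equiv.Perm (Fin n)), ?_⟩
  rintro k ⟨S, rfl, -⟩
  exact S.card_le_univ

lemma card_le_T {n : ℕ} {D : Set ℕ} (S : Finset (Equiv.Perm (Fin n)))
    (hS : ∀ π ∈ S, ∀ σ ∈ S, π ≠ σ →
      ∃ i : Fin n, ((π i : ℤ) - (σ i : ℤ)).natAbs ∈ D) : S.card ≤ T n D :=
  le_csSup (bddAbove_card_differentFamilies n D) ⟨S, rfl, hS⟩

lemma exists_card_eq_T (n : ℕ) (D : Set ℕ) :
    ∃ S : Finset (Equiv.Perm (Fin n)), S.card = T n D ∧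
      ∀ π ∈ S, ∀ σ ∈ S, π ≠ σ →
        ∃ i : Fin n, ((π i : ℤ) - (σ i : ℤ)).natAbs ∈ D :=
  Nat.sSup_mem (s := {k | ∃ S : Finset (Equiv.Perm (Fin n)), S.card = k ∧
    ∀ π ∈ S, ∀ σ ∈ S, π ≠ σ →
      ∃ i : Fin n, ((π i : ℤ) - (σ i : ℤ)).natAbs ∈ D}) ⟨0, ∅, by simp⟩
    (bddAbove_card_differentFamilies n D)

lemma one_le_T (n : ℕ) (D : Set ℕ) : 1 ≤ T n D := by
  have h := card_le_T (D := D) ({1} : Finset (Equiv.Perm (Fin n))) (by simp)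
  simpa using h

/-- If a relabelling `e` of `[n]` carries every edge of `G(D)` avoiding the vertex set `B` to an
edge of `G(D')`, then `T n D` and `T n D'` compare up to the number of ways of placing `B`. -/
lemma T_le_pow_mul_T {n : ℕ} {D D' : Set ℕ} (hD : 0 ∉ D) (e : Equiv.Perm (Fin n))
    (B : Finset (Fin n))
    (h : ∀ x ∉ B, ∀ y ∉ B, ((x : ℤ) - (y : ℤ)).natAbs ∈ D →
      ((e x : ℤ) - (e y : ℤ)).natAbs ∈ D') :
    T n D ≤ n ^ B.card * T n D' := by
  classical
  obtain ⟨S, hcard, hS⟩ := exists_card_eq_T n D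
  let c : Equiv.Perm (Fin n) → (B → Fin n) := fun π b ↦ π.symm b
  have hfiber : ∀ p ∈ S.image c, {π ∈ S | c π = p}.card ≤ T n D' := by
    intro p _
    rw [← Finset.card_image_of_injective _ (mul_right_injective e)]
    apply card_le_T
    simp only [Finset.mem_image, Finset.mem_filter]
    rintro _ ⟨π, ⟨hπ, hπp⟩, rfl⟩ _ ⟨σ, ⟨hσ, hσp⟩, rfl⟩ hne
    obtain ⟨i, hi⟩ := hS π hπ σ hσ (fun h ↦ hne (h ▸ rfl))
    have hsymm : ∀ b ∈ B, π.symm b = σ.symm b := fun b hb ↦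
      congrFun (hπp.trans hσp.symm) ⟨b, hb⟩
    have hvalue : π i ≠ σ i := fun heq ↦ hD (by simpa [heq] using hi)
    have hπB : π i ∉ B := fun hb ↦ hvalue <| by
      have := hsymm _ hb
      rwa [Equiv.symm_apply_apply, Equiv.eq_symm_apply, eq_comm] at this
    have hσB : σ i ∉ B := fun hb ↦ hvalue <| by
      have := hsymm _ hb
      rwa [Equiv.symm_apply_apply, Equiv.symm_apply_eq, eq_comm] at this
    exact ⟨i, h _ hπB _ hσB hi⟩
  calc T n D = S.card := hcard.symm
    _ ≤ T n D' * (S.image c).card := Finset.card_le_mul_card_image S _ hfiber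
    _ ≤ T n D' * n ^ B.card := by
        gcongr
        simpa using (S.image c).card_le_univ
    _ = n ^ B.card * T n D' := mul_comm _ _

/-- Listing `[n]` residue class by residue class modulo `q` turns differences equal to `q` into
differences equal to `1`, up to `2 * q` exceptional vertices. -/
lemma exists_perm_natAbs_sub_eq_iff (n : ℕ) {q : ℕ} (hq : 1 ≤ q) :
    ∃ (e : Equiv.Perm (Fin n)) (B : Finset (Fin n)), B.card ≤ 2 * q ∧
      ∀ x ∉ B, ∀ y ∉ B,
        (((x : ℤ) - (y : ℤ)).natAbs = q ↔ ((e x : ℤ) - (e y : ℤ)).natAbs = 1) := by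
  set m := n / q with hm
  have hmn : q * m ≤ n := Nat.mul_div_le n q
  have hnm : n < q * m + q := by
    simpa [mul_add] using Nat.lt_mul_div_succ n hq
  have hdiv : ∀ x, x < q * m → x / q < m := fun x hx ↦ by
    rwa [Nat.div_lt_iff_lt_mul hq, mul_comm]
  have hblock : ∀ x, x < q * m → m * (x % q) + x / q < q * m := fun x hx ↦ by
    have h1 := hdiv x hx
    have h2 : x % q + 1 ≤ q := Nat.mod_lt x hq
    nlinarith [Nat.mul_le_mul_left m h2]
  let f : ℕ → ℕ := fun x ↦ if x < q * m then m * (x % q) + x / q else x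
  have hdecode : ∀ a b a' b', b < m → b' < m → m * a + b = m * a' + b' → a = a' ∧ b = b' := by
    intro a b a' b' hb hb' h
    have hm0 : 0 < m := by omega
    have h1 := congrArg (· / m) h
    have h2 := congrArg (· % m) h
    simp only [Nat.mul_add_div hm0, Nat.div_eq_of_lt hb, Nat.div_eq_of_lt hb',
      Nat.mul_add_mod, Nat.mod_eq_of_lt hb, Nat.mod_eq_of_lt hb'] at h1 h2
    exact ⟨by simpa using h1, h2⟩
  have hf_lt : ∀ x, x < n → f x < n := by
    intro x hx
    simp only [f]
    split_ifs with h
    · exact (hblock x h).trans_le hmn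
    · exact hx
  have hf_inj : Function.Injective f := by
    intro x y hxy
    simp only [f] at hxy
    split_ifs at hxy with hx hy hy
    · obtain ⟨h1, h2⟩ := hdecode _ _ _ _ (hdiv x hx) (hdiv y hy) hxy
      rw [← Nat.div_add_mod x q, ← Nat.div_add_mod y q, h1, h2]
    · have := hblock x hx; omega
    · have := hblock y hy; omega
    · exact hxy
  have hstep : ∀ x y, x < q * m - q → y < q * m - q → (y = x + q ↔ f y = f x + 1) := by
    intro x y hx hy
    have hx' : x < q * m := by omega
    have hy' : y < q * m := by omega
    have hxq : x + q < q * m := by omega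
    have hfxq : f (x + q) = f x + 1 := by
      simp only [f, if_pos hx', if_pos hxq, Nat.add_mod_right, Nat.add_div_right x hq]
      omega
    rw [← hfxq, hf_inj.eq_iff]
  let g : Fin n → Fin n := fun x ↦ ⟨f x, hf_lt x x.isLt⟩
  have hg : Function.Injective g := fun x y h ↦
    Fin.ext (hf_inj (congrArg Fin.val h))
  refine ⟨Equiv.ofBijective g (Finite.injective_iff_bijective.mp hg),
    Finset.univ.filter fun x : Fin n ↦ q * m - q ≤ x, ?_, ?_⟩
  · rw [← Finset.card_map Fin.valEmbedding]
    calc _ ≤ (Finset.Ico (q * m - q) n).card := by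
          apply Finset.card_le_card
          intro x
          simp only [Finset.mem_map, Finset.mem_filter, Finset.mem_univ, true_and,
            Fin.valEmbedding_apply, Finset.mem_Ico]
          rintro ⟨y, hy, rfl⟩
          exact ⟨hy, y.isLt⟩
      _ ≤ 2 * q := by rw [Nat.card_Ico]; omega
  · intro x hx y hy
    simp only [Finset.mem_filter, Finset.mem_univ, true_and, not_le] at hx hy
    have h1 := hstep x y hx hy
    have h2 := hstep y x hy hx
    simp only [Equiv.ofBijective_apply, g]
    omega

/-- A difference set without `0` and its image under collapsing `q` to `1` give comparable `T`. -/
lemma T_comparable {n q : ℕ} (hn : 1 ≤ n) (hq : 1 ≤ q) {D D' : Set ℕ}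
    (hD : 0 ∉ D) (hD' : 0 ∉ D')
    (h : ∀ d d', d ≠ 0 → d' ≠ 0 → (d = q ↔ d' = 1) → (d ∈ D ↔ d' ∈ D')) :
    T n D ≤ n ^ (2 * q) * T n D' ∧ T n D' ≤ n ^ (2 * q) * T n D := by
  obtain ⟨e, B, hB, he⟩ := exists_perm_natAbs_sub_eq_iff n hq
  have hne : ∀ x y : Fin n, x ≠ y → ((x : ℤ) - (y : ℤ)).natAbs ≠ 0 := by
    intro x y hxy h0
    exact hxy (Fin.ext (by omega))
  have hmem : ∀ x ∉ B, ∀ y ∉ B,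
      (((x : ℤ) - (y : ℤ)).natAbs ∈ D ↔ ((e x : ℤ) - (e y : ℤ)).natAbs ∈ D') := by
    intro x hx y hy
    by_cases hxy : x = y
    · simp [hxy, hD, hD']
    · exact h _ _ (hne _ _ hxy) (hne _ _ (e.injective.ne hxy)) (he x hx y hy)
  have hpow : n ^ B.card ≤ n ^ (2 * q) := Nat.pow_le_pow_right hn hB
  constructor
  · exact (T_le_pow_mul_T hD e B fun x hx y hy ↦ (hmem x hx y hy).mp).trans
      (Nat.mul_le_mul_right _ hpow)
  · refine (T_le_pow_mul_T hD' e.symm (B.map e.toEmbedding) fun x hx y hy hxy ↦ ?_).trans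
      (Nat.mul_le_mul_right _ (by simpa using hpow))
    rw [Finset.mem_map_equiv] at hx hy
    rw [hmem _ hx _ hy]
    simpa using hxy

/-- No boundedness is needed: the default values of `limsup` agree as well. -/
lemma limsup_eq_of_tendsto_sub_zero {u v : ℕ → ℝ}
    (h : Tendsto (fun n ↦ u n - v n) atTop (nhds 0)) :
    atTop.limsup u = atTop.limsup v := by
  have shift : ∀ {u v : ℕ → ℝ}, Tendsto (fun n ↦ u n - v n) atTop (nhds 0) →
      ∀ ε > 0, ∀ a ∈ {a | ∀ᶠ n in atTop, u n ≤ a}, a + ε ∈ {a | ∀ᶠ n in atTop, v n ≤ a} := by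
    intro u v h ε hε a ha
    filter_upwards [ha, h.eventually (lt_mem_nhds (neg_lt_zero.mpr hε))] with n h1 h2
    linarith
  have bdd : ∀ {u v : ℕ → ℝ}, Tendsto (fun n ↦ u n - v n) atTop (nhds 0) →
      BddBelow {a | ∀ᶠ n in atTop, v n ≤ a} → BddBelow {a | ∀ᶠ n in atTop, u n ≤ a} := by
    rintro u v h ⟨b, hb⟩
    exact ⟨b - 1, fun a ha ↦ by linarith [hb (shift h 1 one_pos a ha)]⟩
  have le : ∀ {u v : ℕ → ℝ}, Tendsto (fun n ↦ u n - v n) atTop (nhds 0) →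
      BddBelow {a | ∀ᶠ n in atTop, v n ≤ a} → {a | ∀ᶠ n in atTop, u n ≤ a}.Nonempty →
      sInf {a | ∀ᶠ n in atTop, v n ≤ a} ≤ sInf {a | ∀ᶠ n in atTop, u n ≤ a} := by
    intro u v h hb hne
    refine le_csInf hne fun a ha ↦ le_of_forall_pos_le_add fun ε hε ↦ ?_
    exact csInf_le hb (shift h ε hε a ha)
  have h' : Tendsto (fun n ↦ v n - u n) atTop (nhds 0) := by simpa using h.neg
  rw [limsup_eq, limsup_eq]
  by_cases hne : {a | ∀ᶠ n in atTop, u n ≤ a}.Nonempty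
  · have hne' : {a | ∀ᶠ n in atTop, v n ≤ a}.Nonempty :=
      let ⟨a, ha⟩ := hne; ⟨a + 1, shift h 1 one_pos a ha⟩
    by_cases hb : BddBelow {a | ∀ᶠ n in atTop, u n ≤ a}
    · exact le_antisymm (le h' hb hne') (le h (bdd h' hb) hne)
    · rw [Real.sInf_of_not_bddBelow hb, Real.sInf_of_not_bddBelow fun hb' ↦ hb (bdd h hb')]
  · have hne' : ¬ {a | ∀ᶠ n in atTop, v n ≤ a}.Nonempty :=
      fun ⟨a, ha⟩ ↦ hne ⟨a + 1, shift h' 1 one_pos a ha⟩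
    rw [Set.not_nonempty_iff_eq_empty] at hne hne'
    rw [hne, hne']

lemma abs_logb_sub_logb_le {a b c : ℝ} (ha : 0 < a) (hb : 0 < b) (hc : 0 < c)
    (hab : a ≤ c * b) (hba : b ≤ c * a) :
    |Real.logb 2 a - Real.logb 2 b| ≤ Real.logb 2 c := by
  have h1 := Real.logb_le_logb_of_le one_lt_two ha hab
  have h2 := Real.logb_le_logb_of_le one_lt_two hb hba
  rw [Real.logb_mul hc.ne' hb.ne'] at h1
  rw [Real.logb_mul hc.ne' ha.ne'] at h2
  rw [abs_le]
  constructor <;> linarith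

lemma tendsto_logb_natCast_div_atTop :
    Tendsto (fun n : ℕ ↦ Real.logb 2 n / n) atTop (nhds 0) := by
  have h := (Real.isLittleO_log_id_atTop.tendsto_div_nhds_zero.comp
    (tendsto_natCast_atTop_atTop (R := ℝ))).div_const (Real.log 2)
  rw [zero_div] at h
  refine h.congr fun n ↦ ?_
  simp only [Function.comp_apply, id, Real.logb]
  ring

lemma splitStrength_singleton_eq_one {q : ℕ} (hq : 1 ≤ q) :
    splitStrength {q} {d : ℕ | 0 < d ∧ d ≠ q} =
      splitStrength {1} {d : ℕ | 0 < d ∧ d ≠ 1} := by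
  refine limsup_eq_of_tendsto_sub_zero ?_
  have hlim := tendsto_logb_natCast_div_atTop.const_mul ((4 * q : ℕ) : ℝ)
  rw [mul_zero] at hlim
  refine squeeze_zero_norm' ?_ hlim
  filter_upwards [eventually_ge_atTop 1] with n hn
  have hsingle := T_comparable (D := {q}) (D' := {1}) hn hq
    (by simp; omega) (by simp) (fun d d' _ _ h ↦ by simpa using h)
  have hcompl := T_comparable (D := {d | 0 < d ∧ d ≠ q}) (D' := {d | 0 < d ∧ d ≠ 1}) hn hq
    (by simp) (by simp) (fun d d' _ _ h ↦ by simp only [Set.mem_ofPred_eq]; omega)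
  have hn0 : (0 : ℝ) < n := by exact_mod_cast hn
  have hpos : ∀ D, (0 : ℝ) < T n D := fun D ↦ by exact_mod_cast one_le_T n D
  have hfac : (0 : ℝ) < n.factorial := by exact_mod_cast n.factorial_pos
  have hmul : ∀ {a b c d : ℕ}, a ≤ n ^ (2 * q) * b → c ≤ n ^ (2 * q) * d →
      (a : ℝ) * c / n.factorial ≤ (n : ℝ) ^ (4 * q) * ((b : ℝ) * d / n.factorial) := by
    intro a b c d hab hcd
    rw [← mul_div_assoc]
    refine div_le_div_of_nonneg_right ?_ hfac.le
    have := Nat.mul_le_mul hab hcd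
    calc (a : ℝ) * c ≤ (n ^ (2 * q) * b) * (n ^ (2 * q) * d) := by exact_mod_cast this
      _ = (n : ℝ) ^ (4 * q) * ((b : ℝ) * d) := by ring
  have habs := abs_logb_sub_logb_le
    (div_pos (mul_pos (hpos _) (hpos _)) hfac) (div_pos (mul_pos (hpos _) (hpos _)) hfac)
    (pow_pos hn0 (4 * q)) (hmul hsingle.1 hcompl.1) (hmul hsingle.2 hcompl.2)
  rw [Real.logb_pow] at habs
  rw [← sub_div, Real.norm_eq_abs, abs_div, abs_of_pos hn0, ← mul_div_assoc]
  gcongr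

/-- Proposition: `φ({q}, complement of {q})` does not depend on `q`. -/
theorem splitStrength_singleton_indep (q q' : ℕ) (hq : 1 ≤ q) (hq' : 1 ≤ q') :
    splitStrength {q} {d : ℕ | 0 < d ∧ d ≠ q} =
      splitStrength {q'} {d : ℕ | 0 < d ∧ d ≠ q'} :=
  (splitStrength_singleton_eq_one hq).trans (splitStrength_singleton_eq_one hq').symm
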